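/- arXiv:2103.02910 — 3 statements merged into one kernel-verified Lean document; each statement's English description precedes it below -/
import Mathlib

section
/- Let t0 ∈ ℝ, let ρ0 > ρ∞ > 0, l > 0, g > 0, h > 0, μ > 1 with h > l and ρ∞ > √μ·(g/h). Let τD ≥ (1/(h−l))·ln((√μ·ρ∞ − √μ·(g/h))/(ρ∞ − √μ·(g/h))). Let (t_k)_{k∈ℕ} be a strictly increasing sequence of switching times with t_0 = t0 and t_{k+1} − t_k ≥ τD for all k. Define the reset values (e_k)_{k∈ℕ} recursively by e_0 = ε0 with ε0 ∈ (g/h, ρ0) and e_{k+1} = √μ·((e_k − g/h)·exp(−h·(t_{k+1} − t_k)) + g/h), and define the auxiliary performance signal ε(t) = (e_k − g/h)·exp(−h·(t − t_k)) + g/h for t ∈ [t_k, t_{k+1}). Then for every k ∈ ℕ and every t ∈ [t_k, t_{k+1}), one has g/h ≤ ε(t) < ρ(t), where ρ(t) = (ρ0 − ρ∞)·exp(−l·(t − t0)) + ρ∞. -/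
/-- Lemma 1 of the paper: with dwell time `τD`, the auxiliary performance signal `ε`
(with resets by `√μ` at switching instants) satisfies `g/h ≤ ε(t) < ρ(t)` on each
inter-switch interval. -/
theorem stmt_0
    (t0 ρ0 ρinf l g h μ τD ε0 : ℝ) (T : ℕ → ℝ) (e : ℕ → ℝ)
    (hρinf : ρinf > 0) (hρ0 : ρ0 > ρinf) (hl : l > 0) (hg : g > 0) (hh : h > 0)
    (hμ : μ > 1) (hhl : h > l)
    (hρμ : ρinf > Real.sqrt μ * (g / h))
    (hτ : τD ≥ (1 / (h - l)) *
      Real.log ((Real.sqrt μ * ρinf - Real.sqrt μ * (g / h)) /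
        (ρinf - Real.sqrt μ * (g / h))))
    (hT0 : T 0 = t0) (hTmono : StrictMono T)
    (hTdwell : ∀ k : ℕ, T (k + 1) - T k ≥ τD)
    (hε0l : g / h < ε0) (hε0u : ε0 < ρ0)
    (he0 : e 0 = ε0)
    (herec : ∀ k : ℕ,
      e (k + 1) = Real.sqrt μ * ((e k - g / h) * Real.exp (-h * (T (k + 1) - T k)) + g / h)) :
    ∀ k : ℕ, ∀ t : ℝ, T k ≤ t → t < T (k + 1) →
      g / h ≤ (e k - g / h) * Real.exp (-h * (t - T k)) + g / h ∧
      (e k - g / h) * Real.exp (-h * (t - T k)) + g / h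
        < (ρ0 - ρinf) * Real.exp (-l * (t - t0)) + ρinf := by
  have hhl' : 0 < h - l := by linarith
  have ha : 0 < g / h := div_pos hg hh
  have hs : 1 < Real.sqrt μ := by
    rw [Real.lt_sqrt (by norm_num)]; linarith
  generalize Real.sqrt μ = s at *
  generalize g / h = a at *
  have hsa : a < s * a := by nlinarith
  have hR : 0 < ρ0 - ρinf := by linarith
  have hp : 0 < ρinf - s * a := by linarith
  have hq : 0 < s * ρinf - s * a := by nlinarith
  have key : ∀ k : ℕ, a < e k ∧ e k < (ρ0 - ρinf) * Real.exp (-l * (T k - t0)) + ρinf := by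
    intro k
    induction k with
    | zero => rw [he0, hT0]; simp; exact ⟨hε0l, hε0u⟩
    | succ k ih =>
      obtain ⟨h1, h2⟩ := ih
      have hd : 0 < T (k + 1) - T k := sub_pos.2 (hTmono (Nat.lt_succ_self k))
      have hE : Real.exp (-l * (T (k + 1) - t0))
          = Real.exp (-l * (T k - t0)) * Real.exp (-l * (T (k + 1) - T k)) := by
        rw [← Real.exp_add]; congr 1; ring
      have hdw : T (k + 1) - T k ≥ _ := (hTdwell k).trans' hτ
      rw [herec, hE]
      generalize T (k + 1) - T k = d at *
      have hlog : Real.log ((s * ρinf - s * a) / (ρinf - s * a)) ≤ (h - l) * d := by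
        rw [ge_iff_le, one_div, inv_mul_le_iff₀ hhl'] at hdw
        exact hdw
      have h3 := (Real.log_le_iff_le_exp (div_pos hq hp)).1 hlog
      rw [div_le_iff₀ hp] at h3
      have hX : 0 < Real.exp (-h * d) := Real.exp_pos _
      have hXY : Real.exp ((h - l) * d) * Real.exp (-h * d) = Real.exp (-l * d) := by
        rw [← Real.exp_add]; congr 1; ring
      have hY1 : Real.exp (-l * d) ≤ 1 := Real.exp_le_one_iff.2 (by nlinarith)
      have hE0 : 0 < Real.exp (-l * (T k - t0)) := Real.exp_pos _
      have h4 := mul_le_mul_of_nonneg_right h3 hX.le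
      rw [mul_right_comm, hXY] at h4
      have hY : 0 < Real.exp (-l * d) := Real.exp_pos _
      generalize Real.exp (-l * d) = Y at *
      generalize Real.exp (-h * d) = X at *
      generalize Real.exp (-l * (T k - t0)) = E at *
      have hsX : s * X ≤ Y := by
        have h5 : (s * X) * (ρinf - a) ≤ Y * (ρinf - a) := by nlinarith
        exact le_of_mul_le_mul_right h5 (by linarith)
      have hsX0 : 0 < s * X := by positivity
      constructor
      · nlinarith [mul_pos hsX0 (sub_pos.2 h1)]
      · have h6 := mul_lt_mul_of_pos_left h2 hsX0
        have h7 := mul_le_mul_of_nonneg_left hsX (mul_pos hR hE0).le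
        have h8 := mul_le_mul_of_nonneg_right hY1 hp.le
        linarith
  intro k t ht _
  obtain ⟨h1, h2⟩ := key k
  have hE : Real.exp (-l * (t - t0))
      = Real.exp (-l * (T k - t0)) * Real.exp (-l * (t - T k)) := by
    rw [← Real.exp_add]; congr 1; ring
  have hx : 0 < Real.exp (-h * (t - T k)) := Real.exp_pos _
  have hd : 0 ≤ t - T k := sub_nonneg.2 ht
  have hx1 : Real.exp (-h * (t - T k)) ≤ 1 := Real.exp_le_one_iff.2 (by nlinarith)
  have hxy : Real.exp (-h * (t - T k)) ≤ Real.exp (-l * (t - T k)) :=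
    Real.exp_le_exp.2 (by nlinarith)
  have hE0 : 0 < Real.exp (-l * (T k - t0)) := Real.exp_pos _
  rw [hE]
  constructor
  · linarith [mul_pos (sub_pos.2 h1) hx]
  · have h6 := mul_lt_mul_of_pos_right h2 hx
    have h7 := mul_le_mul_of_nonneg_left hxy (mul_pos hR hE0).le
    have h8 := mul_le_mul_of_nonneg_right hx1 (show 0 ≤ ρinf - a by linarith)
    linarith
end

section
/- Let ρ0 > ρ∞ > 0, l > 0, g > 0, h > 0, μ > 1 with h > l and ρ∞ > √μ·(g/h), and let ε0 ∈ (g/h, ρ0). If Δ > (1/(h−l))·ln((√μ·ρ0 − √μ·(g/h))/(ρ0 − √μ·(g/h))), then √μ·((ε0 − g/h)·exp(−h·Δ) + g/h) < (ρ0 − ρ∞)·exp(−l·Δ) + ρ∞. -/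
/-- Single-reset step in the proof of Lemma 1: if the inter-switch interval `Δ`
exceeds the dwell-time bound, then the reset value `√μ · ε(t₁⁻)` is still strictly
below `ρ(t₁)`. -/
theorem stmt_2
    (ρ0 ρinf l g h μ ε0 Δ : ℝ)
    (hρinf : ρinf > 0) (hρ0 : ρ0 > ρinf) (hl : l > 0) (hg : g > 0) (hh : h > 0)
    (hμ : μ > 1) (hhl : h > l)
    (hρμ : ρinf > Real.sqrt μ * (g / h))
    (hε0l : g / h < ε0) (hε0u : ε0 < ρ0)
    (hΔ : Δ > (1 / (h - l)) *
      Real.log ((Real.sqrt μ * ρ0 - Real.sqrt μ * (g / h)) / (ρ0 - Real.sqrt μ * (g / h)))) :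
    Real.sqrt μ * ((ε0 - g / h) * Real.exp (-h * Δ) + g / h)
      < (ρ0 - ρinf) * Real.exp (-l * Δ) + ρinf := by
  have hs : 1 < Real.sqrt μ := by
    rw [Real.lt_sqrt (by norm_num)]; linarith
  have ha : 0 < g / h := div_pos hg hh
  generalize Real.sqrt μ = s at *
  generalize g / h = a at *
  have hd : 0 < h - l := by linarith
  have hD : 0 < ρ0 - s * a := by linarith
  have hR : 1 < (s * ρ0 - s * a) / (ρ0 - s * a) := by
    rw [lt_div_iff₀ hD]; nlinarith
  have hlog := Real.log_pos hR
  have hΔ0 : 0 < Δ := lt_trans (mul_pos (one_div_pos.mpr hd) hlog) hΔ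
  have h1 : Real.log ((s * ρ0 - s * a) / (ρ0 - s * a)) < (h - l) * Δ := by
    have h2 := mul_lt_mul_of_pos_left hΔ hd
    rwa [← mul_assoc, mul_one_div_cancel hd.ne', one_mul] at h2
  rw [Real.log_lt_iff_lt_exp (by linarith), div_lt_iff₀ hD] at h1
  have hH := Real.exp_pos (-h * Δ)
  have hE : Real.exp (-l * Δ) = Real.exp ((h - l) * Δ) * Real.exp (-h * Δ) := by
    rw [← Real.exp_add]; congr 1; ring
  have hE1 : Real.exp (-l * Δ) < 1 := by
    rw [← Real.exp_zero, Real.exp_lt_exp]; nlinarith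
  have h3 := mul_lt_mul_of_pos_right h1 hH
  have h4 : (s * ρ0 - s * a) * Real.exp (-h * Δ) < (ρ0 - s * a) * Real.exp (-l * Δ) := by
    rw [hE]; linarith
  have h5 : 0 < s * Real.exp (-h * Δ) * (ρ0 - ε0) :=
    mul_pos (mul_pos (by linarith) hH) (by linarith)
  have h6 : 0 < (ρinf - s * a) * (1 - Real.exp (-l * Δ)) :=
    mul_pos (by linarith) (by linarith)
  linarith
end

section
/- Let μ > 1, h > l > 0, g > 0, α > 0, and suppose ρ∞ > √μ·(g/h) and h < α/2. Then (1/(h−l))·ln((√μ·ρ∞ − √μ·(g/h))/(ρ∞ − √μ·(g/h))) > (ln μ)/α. -/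
/-- Key step in the proof of Lemma 2: the dwell time prescribed in Lemma 1 exceeds
the classical dwell-time bound `(ln μ)/α` required for stability of the switched
reference system. -/
theorem stmt_5
    (μ l h g α ρinf : ℝ)
    (hμ : μ > 1) (hl : l > 0) (hhl : h > l) (hg : g > 0) (hα : α > 0)
    (hρμ : ρinf > Real.sqrt μ * (g / h)) (hhα : h < α / 2) :
    (1 / (h - l)) *
      Real.log ((Real.sqrt μ * ρinf - Real.sqrt μ * (g / h)) / (ρinf - Real.sqrt μ * (g / h)))
      > Real.log μ / α := by
  have hh : 0 < h := lt_trans hl hhl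
  have hc : 0 < g / h := div_pos hg hh
  have hs : 1 < Real.sqrt μ := by
    rw [Real.lt_sqrt (by norm_num)]; linarith
  have hls : Real.log (Real.sqrt μ) = Real.log μ / 2 := Real.log_sqrt (by linarith)
  generalize Real.sqrt μ = s at *
  generalize g / h = c at *
  have hd : 0 < ρinf - s * c := by linarith
  have hr : s < (s * ρinf - s * c) / (ρinf - s * c) := by
    rw [lt_div_iff₀ hd]
    have h1 : 0 < (s - 1) * (s * c) := mul_pos (by linarith) (mul_pos (by linarith) hc)
    nlinarith
  have hlog := Real.log_lt_log (by linarith) hr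
  have hL : 0 < Real.log μ := Real.log_pos hμ
  rw [hls] at hlog
  generalize Real.log ((s * ρinf - s * c) / (ρinf - s * c)) = X at *
  have hk : 0 < h - l := by linarith
  show Real.log μ / α < 1 / (h - l) * X
  rw [one_div_mul_eq_div, div_lt_div_iff₀ hα hk]
  have h2 : Real.log μ * (h - l) < Real.log μ * (α / 2) :=
    mul_lt_mul_of_pos_left (by linarith) hL
  have h3 : Real.log μ / 2 * α < X * α := mul_lt_mul_of_pos_right hlog hα
  linarith
end
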